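/- Under the standing setup with s even, and with R = {v ∈ V(G) : x_v ≥ x_z/(2(h+1))}: the subgraph of G induced by V(G) \ R contains at most one edge. -/

import Mathlib

open SimpleGraph Matrix

/-- The adjacency matrix of a simple graph, over `ℝ`. -/
noncomputable def adjMat {V : Type*} (G : SimpleGraph V) : Matrix V V ℝ :=
  fun a b => by classical exact if G.Adj a b then 1 else 0

/-- The spectral radius of a graph: the largest (real) eigenvalue of its adjacency
matrix, expressed as the supremum of the real spectrum. -/
noncomputable def specRad {V : Type*} [Fintype V] [DecidableEq V] (G : SimpleGraph V) : ℝ :=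
  sSup (spectrum ℝ (adjMat G))

/-- A linear forest: an acyclic graph in which every vertex has degree at most 2,
i.e. every connected component is a path. -/
def IsLinearForest {V : Type*} (H : SimpleGraph V) : Prop :=
  H.IsAcyclic ∧ ∀ v, {w | H.Adj v w}.ncard ≤ 2

/-- `G` contains some member of `𝓛 s`, the family of linear forests with `s` edges. -/
def ContainsLinForest {V : Type*} (G : SimpleGraph V) (s : ℕ) : Prop :=
  ∃ H : SimpleGraph V, H ≤ G ∧ IsLinearForest H ∧ H.edgeSet.ncard = s

/-- `G` belongs to `Ex_sp(n, {K_{k+1}, 𝓛_s})`: it is `{K_{k+1}, 𝓛_s}`-free and has the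
maximum spectral radius among all such graphs on `n` vertices. -/
def IsExtremal (n k s : ℕ) (G : SimpleGraph (Fin n)) : Prop :=
  G.CliqueFree (k + 1) ∧ ¬ ContainsLinForest G s ∧
    ∀ H : SimpleGraph (Fin n), H.CliqueFree (k + 1) → ¬ ContainsLinForest H s →
      specRad H ≤ specRad G

/-- The degree of `v` in `G`. -/
noncomputable def degOf {V : Type*} (G : SimpleGraph V) (v : V) : ℕ :=
  {w | G.Adj v w}.ncard

/-- `H` is a linear forest in `G` with `e` edges, supported in `T`. -/
def LFIn {V : Type*} (G H : SimpleGraph V) (e : ℕ) (T : Finset V) : Prop :=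
  H ≤ G ∧ IsLinearForest H ∧ H.edgeSet.ncard = e ∧ ∀ u w, H.Adj u w → u ∈ T

lemma lfIn_bot {V : Type*} (G : SimpleGraph V) : LFIn G ⊥ 0 ∅ := by
  refine ⟨bot_le, ⟨isAcyclic_bot, fun v => by simp⟩, by simp, fun u w h => by simp at h⟩

lemma lfIn_add {V : Type*} [Fintype V] [DecidableEq V] {G H : SimpleGraph V} {e : ℕ} {T : Finset V}
    (hH : LFIn G H e T) {u a : V} (hua : G.Adj u a)
    (hdeg : {w | H.Adj u w}.ncard ≤ 1) (ha : a ∉ T) :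
    LFIn G (H ⊔ edge u a) (e + 1) (insert u (insert a T)) := by
  obtain ⟨h1, ⟨h2, h3⟩, h4, h5⟩ := hH
  have hne : u ≠ a := hua.ne
  have hiso : ∀ w, ¬ H.Adj a w := fun w hw => ha (h5 a w hw)
  have hiso' : ∀ w, ¬ H.Adj w a := fun w hw => hiso w hw.symm
  have hnr : ¬ H.Reachable u a := by
    intro hr
    obtain ⟨w⟩ := hr.symm
    cases w with
    | nil => exact hne rfl
    | cons h _ => exact hiso _ h
  refine ⟨?_, ⟨h2.sup_edge_of_not_reachable hnr, ?_⟩, ?_, ?_⟩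
  · refine sup_le h1 ?_
    intro v w hvw
    rw [edge_adj] at hvw
    rcases hvw with ⟨⟨rfl, rfl⟩ | ⟨rfl, rfl⟩, _⟩
    · exact hua
    · exact hua.symm
  · intro v
    by_cases hvu : v = u
    · subst hvu
      have : {w | (H ⊔ edge v a).Adj v w} ⊆ insert a {w | H.Adj v w} := by
        intro w hw
        simp only [Set.mem_ofPred_eq, sup_adj, edge_adj, Set.mem_insert_iff] at hw ⊢
        grind
      refine (Set.ncard_le_ncard this (Set.toFinite _)).trans ?_
      refine (Set.ncard_insert_le _ _).trans ?_
      omega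
    · by_cases hva : v = a
      · subst hva
        have : {w | (H ⊔ edge u v).Adj v w} ⊆ {u} := by
          intro w hw
          simp only [Set.mem_ofPred_eq, sup_adj, edge_adj, Set.mem_singleton_iff] at hw ⊢
          grind
        refine (Set.ncard_le_ncard this (Set.toFinite _)).trans ?_
        simp
      · have : {w | (H ⊔ edge u a).Adj v w} ⊆ {w | H.Adj v w} := by
          intro w hw
          simp only [Set.mem_ofPred_eq, sup_adj, edge_adj] at hw ⊢
          grind
        exact (Set.ncard_le_ncard this (Set.toFinite _)).trans (h3 v)
  · rw [edgeSet_sup, edgeSet_edge_of_ne hne, Set.union_singleton, Set.ncard_insert_of_notMem, h4]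
    rw [mem_edgeSet]
    exact hiso' u
  · intro v w hvw
    simp only [sup_adj, edge_adj] at hvw
    have := h5 v w
    simp only [Finset.mem_insert]
    grind

lemma ncard_zero_of_iso {V : Type*} {G H : SimpleGraph V} {e : ℕ} {T : Finset V}
    (hH : LFIn G H e T) {u : V} (hu : u ∉ T) : {w | H.Adj u w}.ncard = 0 := by
  have : {w | H.Adj u w} = ∅ := by
    ext w
    simp only [Set.mem_ofPred_eq, Set.mem_empty_iff_false, iff_false]
    exact fun hw => hu (hH.2.2.2 u w hw)
  rw [this, Set.ncard_empty]

/-- Attach private cherries at all vertices of `S`. -/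
lemma lfIn_cherries {V : Type*} [Fintype V] [DecidableEq V] {G : SimpleGraph V} [DecidableRel G.Adj]
    (m : ℕ) : ∀ (S T : Finset V) (H : SimpleGraph V) (e : ℕ), S.card = m → LFIn G H e T →
      Disjoint S T → (∀ v ∈ S, T.card + 3 * m ≤ (G.neighborFinset v).card) →
      ∃ H' T', LFIn G H' (e + 2 * m) T' := by
  induction m with
  | zero => intro S T H e _ hH _ _; exact ⟨H, T, hH⟩
  | succ m ih =>
    intro S T H e hS hH hd hdeg
    obtain ⟨v, hv⟩ : S.Nonempty := by
      rw [← Finset.card_pos]; omega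
    have hvT : v ∉ T := Finset.disjoint_left.mp hd hv
    have hc : 1 < (G.neighborFinset v \ (T ∪ S)).card := by
      have h1 := Finset.le_card_sdiff (T ∪ S) (G.neighborFinset v)
      have h2 := Finset.card_union_le T S
      have h3 := hdeg v hv
      omega
    obtain ⟨a, ha, b, hb, hab⟩ := Finset.one_lt_card.mp hc
    simp only [Finset.mem_sdiff, mem_neighborFinset, Finset.mem_union, not_or] at ha hb
    have hva := ha.1.ne
    have hvb := hb.1.ne
    have h1 := lfIn_add hH ha.1 (by rw [ncard_zero_of_iso hH hvT]; omega) ha.2.1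
    have h2 := lfIn_add h1 hb.1 (by
      have : {w | (H ⊔ edge v a).Adj v w} ⊆ {a} := by
        intro w hw
        have := fun hw => hvT (hH.2.2.2 v w hw)
        simp only [Set.mem_ofPred_eq, sup_adj, edge_adj, Set.mem_singleton_iff] at hw ⊢
        grind
      refine (Set.ncard_le_ncard this (Set.toFinite _)).trans ?_
      simp) (by
      simp only [Finset.mem_insert, not_or]
      exact ⟨hvb.symm, hab.symm, hb.2.1⟩)
    obtain ⟨H', T', h'⟩ := ih (S.erase v) _ _ _ (by rw [Finset.card_erase_of_mem hv]; omega) h2 (by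
      rw [Finset.disjoint_left] at hd ⊢
      intro w hw
      have := hd (Finset.mem_of_mem_erase hw)
      have h5 := Finset.mem_of_mem_erase hw
      have h6 := Finset.ne_of_mem_erase hw
      simp only [Finset.mem_insert, not_or]
      refine ⟨h6, ?_, h6, ?_, this⟩
      · rintro rfl; exact hb.2.2 h5
      · rintro rfl; exact ha.2.2 h5) (by
      intro w hw
      refine le_trans ?_ (hdeg w (Finset.mem_of_mem_erase hw))
      have : (insert v (insert b (insert v (insert a T)))).card ≤ T.card + 3 := by
        have : insert v (insert b (insert v (insert a T))) = insert v (insert b (insert a T)) := by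
          ext; simp only [Finset.mem_insert]; tauto
        rw [this]
        refine (Finset.card_insert_le _ _).trans ?_
        have := Finset.card_insert_le b (insert a T)
        have := Finset.card_insert_le a T
        omega
      omega)
    exact ⟨H', T', by convert h' using 1; omega⟩

/-- A small vertex cover exists if there is no large linear forest. -/
lemma exists_cover {V : Type*} [Fintype V] [DecidableEq V] {G : SimpleGraph V} (s : ℕ)
    (hG : ¬ ContainsLinForest G s) :
    ∃ T : Finset V, T.card ≤ 2 * s ∧ ∀ u w, G.Adj u w → u ∈ T ∨ w ∈ T := by
  by_contra hcon
  push Not at hcon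
  have key : ∀ j ≤ s, ∃ H T, LFIn G H j T ∧ T.card ≤ 2 * j := by
    intro j
    induction j with
    | zero => intro _; exact ⟨⊥, ∅, lfIn_bot G, by simp⟩
    | succ j ih =>
      intro hj
      obtain ⟨H, T, hH, hT⟩ := ih (by omega)
      obtain ⟨u, w, huw, hu, hw⟩ := hcon T (by omega)
      refine ⟨_, _, lfIn_add hH huw (by rw [ncard_zero_of_iso hH hu]; omega) hw, ?_⟩
      have := Finset.card_insert_le u (insert w T)
      have := Finset.card_insert_le w T
      omega
  obtain ⟨H, T, hH, _⟩ := key s le_rfl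
  exact hG ⟨H, hH.1, hH.2.1, hH.2.2.1⟩

/-- Two distinct edges form a linear forest. -/
lemma lfIn_two {V : Type*} [Fintype V] [DecidableEq V] {G : SimpleGraph V} {a b c d : V}
    (hab : G.Adj a b) (hcd : G.Adj c d) (hne : s(a, b) ≠ s(c, d)) :
    ∃ H T, LFIn G H 2 T ∧ T.card ≤ 4 ∧ ∀ v ∈ T, v = a ∨ v = b ∨ v = c ∨ v = d := by
  have h1 := lfIn_add (lfIn_bot G) hab (by simp) (by simp)
  have hdeg : ∀ v, {w | ((⊥ : SimpleGraph V) ⊔ edge a b).Adj v w}.ncard ≤ 1 := by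
    intro v
    have : {w | ((⊥ : SimpleGraph V) ⊔ edge a b).Adj v w} ⊆ {if v = a then b else a} := by
      intro w hw
      simp only [Set.mem_ofPred_eq, sup_adj, edge_adj, Set.mem_singleton_iff, bot_adj] at hw ⊢
      grind
    refine (Set.ncard_le_ncard this (Set.toFinite _)).trans ?_
    simp
  have hcard : ∀ p q : V, (insert p (insert q (insert a (insert b (∅ : Finset V))))).card ≤ 4 :=
    fun p q => Finset.card_le_four
  by_cases hd : d = a ∨ d = b
  · have hc : c ∉ (insert a (insert b (∅ : Finset V))) := by
      intro hc
      simp only [Finset.mem_insert, Finset.notMem_empty, or_false] at hc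
      have := hab.ne
      have := hcd.ne
      apply hne
      rw [Sym2.eq_iff]
      grind
    refine ⟨_, _, lfIn_add h1 hcd.symm (hdeg _) hc, hcard _ _, ?_⟩
    intro v hv
    simp only [Finset.mem_insert, Finset.notMem_empty, or_false] at hv
    tauto
  · have hd' : d ∉ (insert a (insert b (∅ : Finset V))) := by
      simpa using hd
    refine ⟨_, _, lfIn_add h1 hcd (hdeg _) hd', hcard _ _, ?_⟩
    intro v hv
    simp only [Finset.mem_insert, Finset.notMem_empty, or_false] at hv
    tauto

lemma specRad_ge {n : ℕ} (G : SimpleGraph (Fin n)) (y : Fin n → ℝ) (hy : y ≠ 0) (μ : ℝ)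
    (h : adjMat G *ᵥ y = μ • y) : μ ≤ specRad G := by
  unfold specRad
  refine le_csSup (Set.Finite.bddAbove ?_) ?_
  · exact Matrix.finite_spectrum _
  · rw [← Matrix.spectrum_toLin', ← Module.End.hasEigenvalue_iff_mem_spectrum]
    refine Module.End.hasEigenvalue_of_hasEigenvector (x := y) ⟨?_, hy⟩
    rw [Module.End.mem_eigenspace_iff, Matrix.toLin'_apply]
    exact h

/-- The complete bipartite graph with parts of size `h` and `n - h`. -/
def bipG (n h : ℕ) : SimpleGraph (Fin n) where
  Adj a b := ¬ ((a : ℕ) < h ↔ (b : ℕ) < h)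
  symm := ⟨fun a b hab => by tauto⟩
  loopless := ⟨fun a hab => by tauto⟩

lemma bipG_cliqueFree (n h k : ℕ) (hk : 2 ≤ k) : (bipG n h).CliqueFree (k + 1) := by
  have : (bipG n h).CliqueFree 3 := by
    intro t ht
    rw [is3Clique_iff] at ht
    obtain ⟨a, b, c, h1, h2, h3, _⟩ := ht
    simp only [bipG] at h1 h2 h3
    tauto
  exact this.mono (by omega)

lemma bipG_free (n h s : ℕ) (hs : 2 * h < s) : ¬ ContainsLinForest (bipG n h) s := by
  classical
  rintro ⟨H, hH, ⟨_, hd⟩, hc⟩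
  have hsub : H.edgeSet ⊆ ⋃ a ∈ (Finset.univ.filter (fun a : Fin n => (a : ℕ) < h)),
      Set.image (fun w => s(a, w)) {w | H.Adj a w} := by
    intro e he
    induction e using Sym2.ind with
    | _ a b =>
      rw [mem_edgeSet] at he
      have h1 := hH he
      simp only [bipG] at h1
      simp only [Set.mem_iUnion]
      by_cases ha : (a : ℕ) < h
      · exact ⟨a, by simpa using ha, b, he, rfl⟩
      · exact ⟨b, by simpa using (by tauto), a, he.symm, Sym2.eq_swap⟩
  have h1 := Set.ncard_le_ncard hsub (Set.toFinite _)
  have h2 := Finset.set_ncard_biUnion_le (Finset.univ.filter (fun a : Fin n => (a : ℕ) < h))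
    (fun a => Set.image (fun w => s(a, w)) {w | H.Adj a w})
  have h3 : ∑ a ∈ (Finset.univ.filter (fun a : Fin n => (a : ℕ) < h)),
      (Set.image (fun w => s(a, w)) {w | H.Adj a w}).ncard ≤
      ∑ a ∈ (Finset.univ.filter (fun a : Fin n => (a : ℕ) < h)), 2 :=
    Finset.sum_le_sum fun a _ => (Set.ncard_image_le (Set.toFinite _)).trans (hd a)
  have h4 : (Finset.univ.filter (fun a : Fin n => (a : ℕ) < h)).card ≤ h := by
    have := Fin.card_filter_val_lt (n := n) (m := h)
    omega
  rw [Finset.sum_const, smul_eq_mul] at h3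
  omega

lemma adjMat_bipG (n h : ℕ) (v w : Fin n) :
    adjMat (bipG n h) v w = if ((v : ℕ) < h ↔ (w : ℕ) < h) then 0 else 1 := by
  by_cases hvw : (v : ℕ) < h ↔ (w : ℕ) < h
  · rw [if_pos hvw]
    exact if_neg (fun hc => hc hvw)
  · rw [if_neg hvw]
    exact if_pos hvw

lemma bipG_specRad (n h : ℕ) (hh : 0 < h) (hlt : h < n) :
    Real.sqrt h * Real.sqrt ((n : ℝ) - h) ≤ specRad (bipG n h) := by
  classical
  have hn := hlt.le
  have hc1 : (Finset.univ.filter (fun a : Fin n => (a : ℕ) < h)).card = h := by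
    have := Fin.card_filter_val_lt (n := n) (m := h)
    omega
  have hc2 : (Finset.univ.filter (fun a : Fin n => ¬ (a : ℕ) < h)).card = n - h := by
    have := Finset.card_filter_add_card_filter_not (s := (Finset.univ : Finset (Fin n)))
      (fun a : Fin n => (a : ℕ) < h)
    rw [Finset.card_univ, Fintype.card_fin] at this
    omega
  have hnn : (0 : ℝ) ≤ (n : ℝ) - h := by
    have : (h : ℝ) ≤ n := by exact_mod_cast hn
    linarith
  have e1 := Real.mul_self_sqrt (Nat.cast_nonneg (α := ℝ) h)
  have e2 := Real.mul_self_sqrt hnn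
  refine specRad_ge _ (fun v => if (v : ℕ) < h then Real.sqrt ((n : ℝ) - h) else Real.sqrt h)
    ?_ _ ?_
  · intro h0
    have := congrFun h0 ⟨h, hlt⟩
    simp only [lt_irrefl, if_false, Pi.zero_apply] at this
    have hp : (0 : ℝ) < Real.sqrt h := Real.sqrt_pos.mpr (by exact_mod_cast hh)
    linarith
  · ext v
    simp only [Matrix.mulVec, dotProduct, Pi.smul_apply, smul_eq_mul]
    by_cases hv : (v : ℕ) < h
    · have : ∀ w : Fin n, (adjMat (bipG n h) v w *
          if (w : ℕ) < h then Real.sqrt ((n : ℝ) - h) else Real.sqrt h) =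
          if ¬ (w : ℕ) < h then Real.sqrt h else 0 := by
        intro w
        rw [adjMat_bipG]
        by_cases hw : (w : ℕ) < h <;> simp [hv, hw]
      rw [Finset.sum_congr rfl (fun w _ => this w), ← Finset.sum_filter, Finset.sum_const, hc2,
        nsmul_eq_mul, Nat.cast_sub hn, if_pos hv]
      linear_combination (-Real.sqrt h) * e2
    · have : ∀ w : Fin n, (adjMat (bipG n h) v w *
          if (w : ℕ) < h then Real.sqrt ((n : ℝ) - h) else Real.sqrt h) =
          if (w : ℕ) < h then Real.sqrt ((n : ℝ) - h) else 0 := by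
        intro w
        rw [adjMat_bipG]
        by_cases hw : (w : ℕ) < h <;> simp [hv, hw]
      rw [Finset.sum_congr rfl (fun w _ => this w), ← Finset.sum_filter, Finset.sum_const, hc1,
        nsmul_eq_mul, if_neg hv]
      linear_combination (-Real.sqrt ((n : ℝ) - h)) * e1

lemma low_degree_sum {V : Type*} [Fintype V] [DecidableEq V] (G : SimpleGraph V)
    [DecidableRel G.Adj] (d : ℕ) (T : Finset V) (hT : ∀ u w, G.Adj u w → u ∈ T ∨ w ∈ T) :
    ∑ u ∈ Finset.univ.filter (fun u => ¬ d ≤ G.degree u), G.degree u ≤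
      (Finset.univ.filter (fun u => d ≤ G.degree u)).card * Fintype.card V + 2 * (T.card * d) := by
  have hstep : ∀ u ∈ Finset.univ.filter (fun u => ¬ d ≤ G.degree u),
      G.degree u ≤ (if u ∈ T then d else 0) + ∑ w ∈ T, if G.Adj w u then 1 else 0 := by
    intro u hu
    rw [Finset.mem_filter] at hu
    by_cases huT : u ∈ T
    · rw [if_pos huT]; omega
    · rw [if_neg huT, zero_add, ← Finset.card_filter, ← card_neighborFinset_eq_degree]
      refine Finset.card_le_card ?_
      intro w hw
      rw [mem_neighborFinset] at hw
      rw [Finset.mem_filter]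
      exact ⟨(hT u w hw).resolve_left huT, hw.symm⟩
  refine (Finset.sum_le_sum hstep).trans ?_
  rw [Finset.sum_add_distrib, Finset.sum_comm]
  have h1 : ∑ u ∈ Finset.univ.filter (fun u => ¬ d ≤ G.degree u), (if u ∈ T then d else 0) ≤
      T.card * d := by
    calc _ ≤ ∑ u : V, (if u ∈ T then d else 0) :=
          Finset.sum_le_sum_of_subset (Finset.filter_subset _ _)
      _ = T.card * d := by simp
  have h2 : ∑ w ∈ T, ∑ u ∈ Finset.univ.filter (fun u => ¬ d ≤ G.degree u),
      (if G.Adj w u then 1 else 0) ≤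
      ∑ w ∈ T, ((if d ≤ G.degree w then Fintype.card V else 0) + d) := by
    refine Finset.sum_le_sum fun w _ => ?_
    have : ∑ u ∈ Finset.univ.filter (fun u => ¬ d ≤ G.degree u),
      (if G.Adj w u then 1 else 0) ≤ G.degree w := by
      calc _ ≤ ∑ u : V, (if G.Adj w u then 1 else 0) :=
            Finset.sum_le_sum_of_subset (Finset.filter_subset _ _)
        _ = G.degree w := by
            rw [← Finset.card_filter, ← card_neighborFinset_eq_degree, neighborFinset_eq_filter]
    have hlt := G.degree_lt_card_verts w
    split_ifs <;> omega
  have h3 : ∑ w ∈ T, ((if d ≤ G.degree w then Fintype.card V else 0) + d) ≤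
      (Finset.univ.filter (fun u => d ≤ G.degree u)).card * Fintype.card V + T.card * d := by
    rw [Finset.sum_add_distrib, Finset.sum_const, smul_eq_mul]
    gcongr
    calc _ ≤ ∑ u : V, (if d ≤ G.degree u then Fintype.card V else 0) :=
          Finset.sum_le_sum_of_subset (Finset.subset_univ _)
      _ = _ := by rw [← Finset.sum_filter, Finset.sum_const, smul_eq_mul]
  omega

/-- Under the standing setup with `s` even: the subgraph of `G` induced by the complement
of `R = {v : x_v ≥ x_z/(2(h+1))}` contains at most one edge. -/
theorem outside_R_at_most_one_edge_of_even
    (k s n : ℕ) (hk : 2 ≤ k) (hs : 3 ≤ s)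
    (h : ℕ) (hh : h = (s - 1) / 2) (α : ℝ) (hα : α = 1 / (36 * ((h : ℝ) + 1) ^ 3))
    (hn : 28 * ((h : ℝ) + 1) ^ 2 / α ^ 2 ≤ (n : ℝ))
    (G : SimpleGraph (Fin n)) (hG : IsExtremal n k s G)
    (x : Fin n → ℝ) (hxpos : ∀ v, 0 < x v) (hxnorm : ∑ v, x v ^ 2 = 1)
    (heig : adjMat G *ᵥ x = specRad G • x)
    (z : Fin n) (hz : ∀ v, x v ≤ x z)
    (heven : Even s) :
    (G.induce {v : Fin n | x z / (2 * ((h : ℝ) + 1)) ≤ x v}ᶜ).edgeSet.ncard ≤ 1 := by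
  classical
  have hs2 : s = 2 * h + 2 := by
    obtain ⟨m, hm⟩ := heven
    omega
  have hh1 : 1 ≤ h := by omega
  have hh1r : (1 : ℝ) ≤ h := by exact_mod_cast hh1
  obtain ⟨hGk, hGs, hGmax⟩ := hG
  -- size of n
  have hN8 : 36288 * ((h : ℝ) + 1) ^ 8 ≤ n := by
    refine le_trans (le_of_eq ?_) hn
    subst hα
    field_simp
    norm_num
  have hN : 36288 * ((h : ℝ) + 1) ^ 4 ≤ n := by
    refine le_trans ?_ hN8
    have : ((h : ℝ) + 1) ^ 4 ≤ ((h : ℝ) + 1) ^ 8 :=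
      pow_le_pow_right₀ (by linarith) (by norm_num)
    linarith
  have hp2 : ((h : ℝ) + 1) ≤ ((h : ℝ) + 1) ^ 4 := le_self_pow₀ (by linarith) (by norm_num)
  have hp3 : ((h : ℝ) + 1) ^ 2 ≤ ((h : ℝ) + 1) ^ 4 :=
    pow_le_pow_right₀ (by linarith) (by norm_num)
  have hhn : h < n := by
    have : (h : ℝ) < n := by linarith
    exact_mod_cast this
  -- spectral radius lower bound
  set ρ := specRad G with hρ
  have hρ1 : Real.sqrt h * Real.sqrt ((n : ℝ) - h) ≤ ρ :=
    (bipG_specRad n h hh1 hhn).trans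
      (hGmax _ (bipG_cliqueFree n h k hk) (bipG_free n h s (by omega)))
  have hρ0 : 0 ≤ ρ := le_trans (by positivity) hρ1
  have hρ2 : (h : ℝ) * ((n : ℝ) - h) ≤ ρ ^ 2 := by
    have h0 : (0 : ℝ) ≤ (n : ℝ) - h := by linarith
    calc (h : ℝ) * ((n : ℝ) - h) = (Real.sqrt h * Real.sqrt ((n : ℝ) - h)) ^ 2 := by
          rw [mul_pow, Real.sq_sqrt (by linarith), Real.sq_sqrt h0]
      _ ≤ ρ ^ 2 := pow_le_pow_left₀ (by positivity) hρ1 2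
  have hρ3 : 2 * ((h : ℝ) + 1) * (3 * h + 4) ≤ ρ := by
    refine le_of_sq_le_sq ?_ hρ0
    refine le_trans ?_ hρ2
    have a1 : 2 * ((h : ℝ) + 1) * (3 * h + 4) ≤ 8 * ((h : ℝ) + 1) ^ 2 := by nlinarith
    have a2 : (2 * ((h : ℝ) + 1) * (3 * h + 4)) ^ 2 ≤ (8 * ((h : ℝ) + 1) ^ 2) ^ 2 :=
      pow_le_pow_left₀ (by positivity) a1 2
    have a3 : (8 * ((h : ℝ) + 1) ^ 2) ^ 2 = 64 * ((h : ℝ) + 1) ^ 4 := by ring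
    have a4 : (n : ℝ) - h ≤ h * ((n : ℝ) - h) := by nlinarith
    linarith
  -- eigenvalue equation
  have hadj : ∀ v w, adjMat G v w = if G.Adj v w then 1 else 0 := by
    intro v w
    unfold adjMat
    split_ifs <;> rfl
  have heq : ∀ v, ∑ w ∈ G.neighborFinset v, x w = ρ * x v := by
    intro v
    have := congrFun heig v
    simp only [Matrix.mulVec, dotProduct, Pi.smul_apply, smul_eq_mul, hadj, ite_mul, one_mul,
      zero_mul] at this
    rw [← this, ← Finset.sum_filter, neighborFinset_eq_filter]
  have hxz := hxpos z
  set c : ℝ := x z / (2 * ((h : ℝ) + 1)) with hc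
  have hcz : c * (2 * ((h : ℝ) + 1)) = x z := by
    rw [hc]; field_simp
  have hc0 : 0 < c := by rw [hc]; positivity
  set d := 3 * h + 4 with hd
  have hRdeg : ∀ v, c ≤ x v → d ≤ G.degree v := by
    intro v hv
    have h1 : ρ * x v ≤ G.degree v * x z := by
      rw [← heq v, ← card_neighborFinset_eq_degree, ← nsmul_eq_mul]
      exact Finset.sum_le_card_nsmul _ _ _ (fun w _ => hz w)
    have h2 : ((d : ℕ) : ℝ) * x z ≤ G.degree v * x z := by
      refine le_trans ?_ h1
      have h3 : 2 * ((h : ℝ) + 1) * (3 * h + 4) * c ≤ ρ * x v := by gcongr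
      refine le_trans (le_of_eq ?_) h3
      rw [hd, ← hcz]
      push_cast
      ring
    exact_mod_cast le_of_mul_le_mul_right h2 hxz
  set D := Finset.univ.filter (fun u => d ≤ G.degree u) with hD
  set R := Finset.univ.filter (fun u => c ≤ x u) with hR
  have hRD : R ⊆ D := by
    intro v hv
    rw [hR, Finset.mem_filter] at hv
    rw [hD, Finset.mem_filter]
    exact ⟨hv.1, hRdeg v hv.2⟩
  -- few high degree vertices
  have hDcard : D.card ≤ h := by
    by_contra hcon
    obtain ⟨S, hSD, hS⟩ := Finset.exists_subset_card_eq (show h + 1 ≤ D.card by omega)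
    obtain ⟨H', T', hH'⟩ := lfIn_cherries (G := G) (h + 1) S ∅ ⊥ 0 hS (lfIn_bot G) (by simp) (by
      intro v hv
      have := hSD hv
      rw [hD, Finset.mem_filter] at this
      rw [card_neighborFinset_eq_degree, Finset.card_empty]
      omega)
    exact hGs ⟨H', hH'.1, hH'.2.1, by rw [hH'.2.2.1]; omega⟩
  -- R is large
  have hRcard : h ≤ R.card := by
    by_contra hcon
    obtain ⟨T, hT1, hT2⟩ := exists_cover s hGs
    have hlow := low_degree_sum G d T hT2
    rw [Fintype.card_fin, ← hD] at hlow
    have hsum : ρ ^ 2 * x z ≤ ∑ u, (G.degree u : ℝ) * x u := by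
      have h1 : ρ * x z ≤ ∑ u, x u := by
        rw [← heq z]
        exact Finset.sum_le_sum_of_subset_of_nonneg (Finset.subset_univ _)
          (fun u _ _ => (hxpos u).le)
      have h2 : ρ * ∑ u, x u = ∑ u, (G.degree u : ℝ) * x u := by
        rw [Finset.mul_sum, ← Finset.sum_congr rfl (fun u _ => heq u)]
        simp only [neighborFinset_eq_filter, Finset.sum_filter]
        rw [Finset.sum_comm]
        refine Finset.sum_congr rfl fun u _ => ?_
        rw [← Finset.sum_filter, Finset.sum_const, nsmul_eq_mul,
          ← card_neighborFinset_eq_degree, neighborFinset_eq_filter]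
        simp only [G.adj_comm]
      rw [← h2, pow_two, mul_assoc]
      gcongr
    have hub : ∑ u, (G.degree u : ℝ) * x u ≤
        R.card * (n * x z) + ((∑ u ∈ D \ R, G.degree u + ∑ u ∈ Finset.univ.filter
          (fun u => ¬ d ≤ G.degree u), G.degree u : ℕ) : ℝ) * c := by
      have hsplit : ∑ u, (G.degree u : ℝ) * x u = ∑ u ∈ R, (G.degree u : ℝ) * x u +
          ∑ u ∈ D \ R, (G.degree u : ℝ) * x u + ∑ u ∈ Finset.univ.filter
          (fun u => ¬ d ≤ G.degree u), (G.degree u : ℝ) * x u := by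
        rw [← Finset.sum_filter_add_sum_filter_not Finset.univ (fun u => d ≤ G.degree u), ← hD,
          ← Finset.sum_sdiff hRD]
        ring
      rw [hsplit]
      push_cast
      rw [add_mul, Finset.sum_mul, Finset.sum_mul, add_assoc]
      have hlt : ∀ u, u ∉ R → x u ≤ c := by
        intro u hu
        rw [hR, Finset.mem_filter] at hu
        by_contra hcon2
        exact hu ⟨Finset.mem_univ _, by linarith⟩
      refine add_le_add ?_ (add_le_add ?_ ?_)
      · rw [← nsmul_eq_mul]
        refine Finset.sum_le_card_nsmul _ _ _ (fun u _ => ?_)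
        have h1 : (G.degree u : ℝ) ≤ n := by
          have := G.degree_lt_card_verts u
          rw [Fintype.card_fin] at this
          exact_mod_cast this.le
        exact mul_le_mul h1 (hz u) (hxpos u).le (by positivity)
      · refine Finset.sum_le_sum fun u hu => ?_
        rw [Finset.mem_sdiff] at hu
        have := hlt u hu.2
        gcongr
      · refine Finset.sum_le_sum fun u hu => ?_
        rw [Finset.mem_filter] at hu
        have := hlt u (fun hr => hu.2 (by
          have := hRD hr
          rw [hD, Finset.mem_filter] at this
          exact this.2))
        gcongr
    have hDR : ∑ u ∈ D \ R, G.degree u ≤ (D \ R).card * n := by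
      rw [← smul_eq_mul]
      refine Finset.sum_le_card_nsmul _ _ _ (fun u _ => ?_)
      have := G.degree_lt_card_verts u
      rw [Fintype.card_fin] at this
      exact this.le
    have hDRc : (D \ R).card + R.card = D.card := Finset.card_sdiff_add_card_eq_card hRD
    have hB : ∑ u ∈ D \ R, G.degree u + ∑ u ∈ Finset.univ.filter
          (fun u => ¬ d ≤ G.degree u), G.degree u + R.card * n ≤
          2 * (h * n) + 2 * (2 * s * d) := by
      have h1 : D.card * n ≤ h * n := Nat.mul_le_mul_right _ hDcard
      have h2 : T.card * d ≤ 2 * s * d := Nat.mul_le_mul_right _ hT1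
      have h3 : (D \ R).card * n + R.card * n = D.card * n := by rw [← add_mul, hDRc]
      omega
    set B := ∑ u ∈ D \ R, G.degree u + ∑ u ∈ Finset.univ.filter
          (fun u => ¬ d ≤ G.degree u), G.degree u with hBdef
    have hBr : (B : ℝ) + R.card * n ≤ 2 * (h * n) + 2 * (2 * (2 * h + 2) * (3 * h + 4)) := by
      rw [hs2, hd] at hB
      exact_mod_cast hB
    have hr : (R.card : ℝ) + 1 ≤ h := by
      have : R.card + 1 ≤ h := by omega
      exact_mod_cast this
    have hfin : (h : ℝ) * ((n : ℝ) - h) * x z ≤ R.card * (n * x z) + B * c :=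
      ((mul_le_mul_of_nonneg_right hρ2 hxz.le).trans hsum).trans hub
    rw [← hcz] at hfin
    have hfin2 : (h : ℝ) * ((n : ℝ) - h) * (2 * ((h : ℝ) + 1)) ≤
        R.card * (n * (2 * ((h : ℝ) + 1))) + B := by
      refine le_of_mul_le_mul_right ?_ hc0
      linarith
    have hrn : (R.card : ℝ) * (n * (2 * h + 1)) ≤ (h - 1) * (n * (2 * h + 1)) := by
      have : (R.card : ℝ) ≤ h - 1 := by linarith
      gcongr
    have key : ((h : ℝ) + 1) * n ≤ ((h : ℝ) + 1) * (2 * h ^ 2 + 8 * (3 * h + 4)) := by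
      nlinarith
    have key2 := le_of_mul_le_mul_left key (by linarith)
    nlinarith
  -- final contradiction
  by_contra hcon
  obtain ⟨e₁, he₁, e₂, he₂, hne⟩ := (Set.one_lt_ncard (Set.toFinite _)).mp (not_le.mp hcon)
  induction e₁ using Sym2.ind with
  | _ a b =>
  induction e₂ using Sym2.ind with
  | _ p q =>
  rw [mem_edgeSet, comap_adj] at he₁ he₂
  obtain ⟨H, T, hH, hT4, hT⟩ := lfIn_two he₁ he₂ (by
    intro hcon2
    apply hne
    rw [Sym2.eq_iff] at hcon2 ⊢
    simpa [Subtype.ext_iff] using hcon2)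
  obtain ⟨S, hSR, hS⟩ := Finset.exists_subset_card_eq hRcard
  obtain ⟨H', T', hH'⟩ := lfIn_cherries (G := G) h S T H 2 hS hH (by
    rw [Finset.disjoint_left]
    intro v hv hvT
    have h1 := hSR hv
    rw [hR, Finset.mem_filter] at h1
    rcases hT v hvT with rfl | rfl | rfl | rfl
    · exact a.2 h1.2
    · exact b.2 h1.2
    · exact p.2 h1.2
    · exact q.2 h1.2) (by
    intro v hv
    have := hRD (hSR hv)
    rw [hD, Finset.mem_filter] at this
    rw [card_neighborFinset_eq_degree]
    omega)
  exact hGs ⟨H', hH'.1, hH'.2.1, by rw [hH'.2.2.1]; omega⟩
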